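/- Productivity II (Böhm trees without ⊥): if t and all the types in Γ are tail finite and Γ ⊢ e : t is derivable in λ•→, then the Böhm tree BT(e) of e contains no occurrence of ⊥. -/

import Mathlib

namespace LambdaBullet

/-- Head constructors for pseudo-types. -/
inductive TyHead : Type
  | var (n : ℕ)
  | nat
  | prod
  | arrow
  | bullet

/-- Arity of each pseudo-type constructor. -/
def tyArity : TyHead → Type
  | .var _ => Empty
  | .nat => Empty
  | .prod => Bool
  | .arrow => Bool
  | .bullet => Unit

/-- The polynomial functor whose M-type is the type of pseudo-types. -/
def TyP : PFunctor := ⟨TyHead, tyArity⟩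

/-- Pseudo-types: possibly infinite coinductively generated trees. -/
abbrev PseudoType := TyP.M

/-- Type variable. -/
def tvar (n : ℕ) : PseudoType := PFunctor.M.mk ⟨TyHead.var n, Empty.elim⟩
/-- The type `Nat`. -/
def tnat : PseudoType := PFunctor.M.mk ⟨TyHead.nat, Empty.elim⟩
/-- Product type. -/
def tprod (t s : PseudoType) : PseudoType :=
  PFunctor.M.mk ⟨TyHead.prod, fun b => bif b then s else t⟩
/-- Arrow type. -/
def tarrow (t s : PseudoType) : PseudoType :=
  PFunctor.M.mk ⟨TyHead.arrow, fun b => bif b then s else t⟩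
/-- Delay type `•t`. -/
def tbullet (t : PseudoType) : PseudoType :=
  PFunctor.M.mk ⟨TyHead.bullet, fun _ => t⟩
/-- Iterated delay `•ⁿ t`. -/
def tbulletN (n : ℕ) (t : PseudoType) : PseudoType := tbullet^[n] t

/-- `Child t s` holds iff `s` is an immediate subtree of `t`. -/
def Child (t s : PseudoType) : Prop := ∃ b : TyP.B t.dest.1, t.dest.2 b = s

/-- `Subtree t s` holds iff `s` is a subtree of `t`. -/
def Subtree (t s : PseudoType) : Prop := Relation.ReflTransGen Child t s

/-- A pseudo-type is regular if it has finitely many distinct subtrees. -/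
def Regular (t : PseudoType) : Prop := {s | Subtree t s}.Finite

/-- The root of the tree is a `•`. -/
def headIsBullet (t : PseudoType) : Prop := t.dest.1 = TyHead.bullet

/-- A pseudo-type is guarded if every infinite path in its tree has
infinitely many `•`'s. -/
def Guarded (t : PseudoType) : Prop :=
  ∀ f : ℕ → PseudoType, f 0 = t → (∀ n, Child (f n) (f (n + 1))) →
    ∀ N, ∃ n, N ≤ n ∧ headIsBullet (f n)

/-- A type is a regular and guarded pseudo-type. -/
def IsType (t : PseudoType) : Prop := Regular t ∧ Guarded t

/-- `•^∞`: the unique pseudo-type satisfying `•^∞ = • •^∞`. -/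
def binf : PseudoType := PFunctor.M.corec (fun _ : Unit => ⟨TyHead.bullet, fun _ => ()⟩) ()

/-- Constants. -/
inductive Const : Type
  | pair
  | cfst
  | csnd
  | zero
  | succ

/-- Expressions (with de Bruijn indices for variables). -/
inductive Expr : Type
  | var (x : ℕ)
  | const (k : Const)
  | lam (e : Expr)
  | app (e₁ e₂ : Expr)

def liftRen (f : ℕ → ℕ) : ℕ → ℕ
  | 0 => 0
  | n + 1 => f n + 1

def rename (f : ℕ → ℕ) : Expr → Expr
  | .var n => .var (f n)
  | .const k => .const k
  | .lam e => .lam (rename (liftRen f) e)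
  | .app a b => .app (rename f a) (rename f b)

def liftSub (ρ : ℕ → Expr) : ℕ → Expr
  | 0 => .var 0
  | n + 1 => rename Nat.succ (ρ n)

/-- Simultaneous (capture-avoiding) substitution. -/
def substE (ρ : ℕ → Expr) : Expr → Expr
  | .var n => ρ n
  | .const k => .const k
  | .lam e => .lam (substE (liftSub ρ) e)
  | .app a b => .app (substE ρ a) (substE ρ b)

/-- `subst0 e f` is `e[f/x]` for the topmost variable `x`. -/
def subst0 (e f : Expr) : Expr :=
  substE (fun n => match n with | 0 => f | n + 1 => .var n) e

/-- The pair `⟨e₁, e₂⟩`. -/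
def mkPair (e₁ e₂ : Expr) : Expr := .app (.app (.const .pair) e₁) e₂

/-- Evaluation contexts E ::= [] | E e | fst E | snd E | succ E. -/
inductive ECtx : Type
  | hole
  | app (E : ECtx) (e : Expr)
  | fst (E : ECtx)
  | snd (E : ECtx)
  | succ (E : ECtx)

/-- Plugging an expression into an evaluation context. -/
def ECtx.plug : ECtx → Expr → Expr
  | .hole, e => e
  | .app E f, e => .app (E.plug e) f
  | .fst E, e => .app (.const .cfst) (E.plug e)
  | .snd E, e => .app (.const .csnd) (E.plug e)
  | .succ E, e => .app (.const .succ) (E.plug e)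

/-- Head reduction rules. -/
inductive HeadRed : Expr → Expr → Prop
  | beta (e f) : HeadRed (.app (.lam e) f) (subst0 e f)
  | fst (e₁ e₂) : HeadRed (.app (.const .cfst) (mkPair e₁ e₂)) e₁
  | snd (e₁ e₂) : HeadRed (.app (.const .csnd) (mkPair e₁ e₂)) e₂

/-- Weak head (call-by-name) reduction: head rules closed under evaluation contexts. -/
def Red (a b : Expr) : Prop :=
  ∃ (E : ECtx) (e f : Expr), HeadRed e f ∧ a = E.plug e ∧ b = E.plug f

/-- Many-step reduction. -/
def RedStar : Expr → Expr → Prop := Relation.ReflTransGen Red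

/-- (Weak head) normal forms. -/
def NormalForm (e : Expr) : Prop := ∀ f, ¬ Red e f

/-- Typing contexts: finite maps from (de Bruijn) variables to types. -/
def Ctx : Type := ℕ → Option PseudoType

/-- Extending a typing context with a type for the topmost variable. -/
def Ctx.cons (t : PseudoType) (Γ : Ctx) : Ctx :=
  fun n => match n with | 0 => some t | n + 1 => Γ n

/-- The type assignment κ for constants. -/
inductive KappaTy : Const → PseudoType → Prop
  | pair {t s} : IsType t → IsType s →
      KappaTy .pair (tarrow t (tarrow s (tprod t s)))
  | fst {t s} : IsType t → IsType s →
      KappaTy .cfst (tarrow (tprod t s) t)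
  | snd {t s} : IsType t → IsType s →
      KappaTy .csnd (tarrow (tprod t s) s)
  | zero : KappaTy .zero tnat
  | succ : KappaTy .succ (tarrow tnat tnat)

/-- The type assignment system λ•→. -/
inductive Types : Ctx → Expr → PseudoType → Prop
  | ax {Γ x t} : Γ x = some t → IsType t → Types Γ (.var x) t
  | const {Γ k t} : KappaTy k t → Types Γ (.const k) t
  | bulletI {Γ e t} : Types Γ e t → Types Γ e (tbullet t)
  | arrowI {Γ e n t s} :
      Types (Ctx.cons (tbulletN n t) Γ) e (tbulletN n s) →
      Types Γ (.lam e) (tbulletN n (tarrow t s))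
  | arrowE {Γ e₁ e₂ n t s} :
      Types Γ e₁ (tbulletN n (tarrow t s)) → Types Γ e₂ (tbulletN n t) →
      Types Γ (.app e₁ e₂) (tbulletN n s)


/-- The spine application `h e₁ … eₙ`. -/
def spineApp (h : Expr) (args : List Expr) : Expr := args.foldl Expr.app h

/-- `e` has a weak head normal form. -/
def HasWhnf (e : Expr) : Prop := ∃ f, RedStar e f ∧ NormalForm f

/-- A pseudo-type is `•^∞`-free if none of its subtrees is `•^∞`. -/
def BinfFree (t : PseudoType) : Prop := ∀ s, Subtree t s → s ≠ binf

/-- One step of the Lévy-Longo tree unfolding: `LLSub e a` holds iff `a` is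
an immediate subterm of the Lévy-Longo tree decomposition of `e`
(the body of the abstraction, or one of the arguments of the variable-
or constant-headed spine that `e` reduces to). -/
inductive LLSub : Expr → Expr → Prop
  | lam {e f} : RedStar e (.lam f) → LLSub e f
  | var {e x args a} : RedStar e (spineApp (.var x) args) → a ∈ args → LLSub e a
  | const {e k args a} : RedStar e (spineApp (.const k) args) →
      NormalForm (spineApp (.const k) args) → a ∈ args → LLSub e a

/-- The Lévy-Longo tree of `e` has no `⊥`: every expression reachable in the
coinductive unfolding of the Lévy-Longo tree of `e` has a weak head normal
form (`⊥` is placed at a node exactly when the corresponding expression has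
no weak head normal form). -/
def LLTBotFree (e : Expr) : Prop :=
  ∀ f, Relation.ReflTransGen LLSub e f → HasWhnf f

/-- Peeling the leading abstractions in the head-normalisation process:
`Peel e g` holds iff there is a sequence `e = e₀`, `eᵢ ⟶* λx.eᵢ₊₁`,
ending at `g`. -/
inductive Peel : Expr → Expr → Prop
  | refl (e) : Peel e e
  | step {e f g} : Peel e f → RedStar f (.lam g) → Peel e g

/-- `e` has a head normal form. -/
def HasHnf (e : Expr) : Prop :=
  ∃ g, Peel e g ∧
    ((∃ x args, RedStar g (spineApp (.var x) args)) ∨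
      (∃ k args, RedStar g (spineApp (.const k) args) ∧
        NormalForm (spineApp (.const k) args)))

/-- One step of the Böhm tree unfolding: `BSub e a` holds iff `a` is one of
the arguments `fᵢ` in the head normal form `λx₁…xₖ. h f₁…fₙ` of `e`. -/
inductive BSub : Expr → Expr → Prop
  | var {e g x args a} : Peel e g → RedStar g (spineApp (.var x) args) →
      a ∈ args → BSub e a
  | const {e g k args a} : Peel e g → RedStar g (spineApp (.const k) args) →
      NormalForm (spineApp (.const k) args) → a ∈ args → BSub e a

/-- The Böhm tree of `e` has no `⊥`: every expression reachable in the
coinductive unfolding of the Böhm tree of `e` has a head normal form. -/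
def BTBotFree (e : Expr) : Prop :=
  ∀ f, Relation.ReflTransGen BSub e f → HasHnf f

/-- `AltStep u v` holds iff `u = •ⁿ(t₁ → v)` for some `n` and `t₁`. -/
def AltStep (u v : PseudoType) : Prop := ∃ n t₁, u = tbulletN n (tarrow t₁ v)

/-- `u` is an infinite alternation of `•`'s and `→`'s, i.e. of the form
`•^{n₁}(t₁ → •^{n₂}(t₂ → …))` continuing forever. -/
def IsInfAlt (u : PseudoType) : Prop :=
  ∃ f : ℕ → PseudoType, f 0 = u ∧ ∀ n, AltStep (f n) (f (n + 1))

/-- A pseudo-type is tail finite if it is `•^∞`-free and does not contain an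
infinite alternation of `•`'s and `→`'s. -/
def TailFinite (t : PseudoType) : Prop :=
  BinfFree t ∧ ∀ s, Subtree t s → ¬ IsInfAlt s


/-! ### Elementary facts on pseudo-types -/

theorem dest_bullet (t : PseudoType) :
    (tbullet t).dest = ⟨TyHead.bullet, fun _ => t⟩ := PFunctor.M.dest_mk _
theorem dest_prod (t s : PseudoType) :
    (tprod t s).dest = ⟨TyHead.prod, fun b => bif b then s else t⟩ := PFunctor.M.dest_mk _
theorem dest_arrow (t s : PseudoType) :
    (tarrow t s).dest = ⟨TyHead.arrow, fun b => bif b then s else t⟩ := PFunctor.M.dest_mk _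
theorem dest_nat : tnat.dest = ⟨TyHead.nat, Empty.elim⟩ := PFunctor.M.dest_mk _
theorem dest_var (n : ℕ) : (tvar n).dest = ⟨TyHead.var n, Empty.elim⟩ := PFunctor.M.dest_mk _

theorem head_bullet (t : PseudoType) : (tbullet t).dest.1 = TyHead.bullet := by
  rw [dest_bullet]
theorem head_prod (t s : PseudoType) : (tprod t s).dest.1 = TyHead.prod := by
  rw [dest_prod]
theorem head_arrow (t s : PseudoType) : (tarrow t s).dest.1 = TyHead.arrow := by
  rw [dest_arrow]
theorem head_nat : tnat.dest.1 = TyHead.nat := by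
  rw [dest_nat]
theorem head_var (n : ℕ) : (tvar n).dest.1 = TyHead.var n := by
  rw [dest_var]

theorem bullet_inj {t s : PseudoType} (h : tbullet t = tbullet s) : t = s := by
  have h := congrArg PFunctor.M.dest h
  rw [dest_bullet, dest_bullet] at h
  have h := eq_of_heq (Sigma.mk.inj h).2
  exact congrFun h ()

theorem prod_inj {t s t' s' : PseudoType} (h : tprod t s = tprod t' s') : t = t' ∧ s = s' := by
  have h := congrArg PFunctor.M.dest h
  rw [dest_prod, dest_prod] at h
  have h := eq_of_heq (Sigma.mk.inj h).2
  exact ⟨congrFun h false, congrFun h true⟩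

theorem arrow_inj {t s t' s' : PseudoType} (h : tarrow t s = tarrow t' s') :
    t = t' ∧ s = s' := by
  have h := congrArg PFunctor.M.dest h
  rw [dest_arrow, dest_arrow] at h
  have h := eq_of_heq (Sigma.mk.inj h).2
  exact ⟨congrFun h false, congrFun h true⟩

theorem ty_cases (t : PseudoType) :
    (∃ n, t = tvar n) ∨ t = tnat ∨ (∃ u v, t = tprod u v) ∨ (∃ u v, t = tarrow u v) ∨
      ∃ u, t = tbullet u := by
  rw [← PFunctor.M.mk_dest t]
  rcases t.dest with ⟨hd, f⟩
  cases hd with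
  | var n => left; refine ⟨n, ?_⟩; unfold tvar; congr; funext b; exact b.elim
  | nat => right; left; unfold tnat; congr; funext b; exact b.elim
  | prod =>
    right; right; left; refine ⟨f false, f true, ?_⟩; unfold tprod; congr; funext b
    cases b <;> rfl
  | arrow =>
    right; right; right; left; refine ⟨f false, f true, ?_⟩; unfold tarrow; congr; funext b
    cases b <;> rfl
  | bullet =>
    right; right; right; right; exact ⟨f (), rfl⟩

theorem child_bullet {t s : PseudoType} : Child (tbullet t) s ↔ s = t := by
  unfold Child; rw [dest_bullet]
  exact ⟨fun ⟨_, h⟩ => h.symm, fun h => ⟨(), h.symm⟩⟩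

theorem child_prod {t u s : PseudoType} : Child (tprod t u) s ↔ s = t ∨ s = u := by
  unfold Child; rw [dest_prod]
  constructor
  · rintro ⟨b, h⟩
    cases b
    · exact Or.inl h.symm
    · exact Or.inr h.symm
  · rintro (h | h)
    · exact ⟨false, h.symm⟩
    · exact ⟨true, h.symm⟩

theorem child_arrow {t u s : PseudoType} : Child (tarrow t u) s ↔ s = t ∨ s = u := by
  unfold Child; rw [dest_arrow]
  constructor
  · rintro ⟨b, h⟩
    cases b
    · exact Or.inl h.symm
    · exact Or.inr h.symm
  · rintro (h | h)
    · exact ⟨false, h.symm⟩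
    · exact ⟨true, h.symm⟩

theorem child_nat {s : PseudoType} : ¬ Child tnat s := by
  unfold Child; rw [dest_nat]
  rintro ⟨b, _⟩; exact b.elim

theorem bulletN_zero (t : PseudoType) : tbulletN 0 t = t := rfl
theorem bulletN_succ (n : ℕ) (t : PseudoType) :
    tbulletN (n + 1) t = tbullet (tbulletN n t) := Function.iterate_succ_apply' _ _ _
theorem bulletN_add (m n : ℕ) (t : PseudoType) :
    tbulletN (m + n) t = tbulletN m (tbulletN n t) := Function.iterate_add_apply _ _ _ _

theorem bulletN_inj {n : ℕ} {t s : PseudoType} (h : tbulletN n t = tbulletN n s) : t = s := by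
  induction n with
  | zero => exact h
  | succ n ih => rw [bulletN_succ, bulletN_succ] at h; exact ih (bullet_inj h)

/-- Not a bullet at the root. -/
def NB (t : PseudoType) : Prop := t.dest.1 ≠ TyHead.bullet

theorem nb_prod (t s : PseudoType) : NB (tprod t s) := by unfold NB; rw [head_prod]; intro h; cases h
theorem nb_arrow (t s : PseudoType) : NB (tarrow t s) := by unfold NB; rw [head_arrow]; intro h; cases h
theorem nb_nat : NB tnat := by unfold NB; rw [head_nat]; intro h; cases h
theorem nb_var (n : ℕ) : NB (tvar n) := by unfold NB; rw [head_var]; intro h; cases h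
theorem not_nb_bullet (t : PseudoType) : ¬ NB (tbullet t) := fun h => h (head_bullet t)

theorem nb_or (t : PseudoType) : NB t ∨ ∃ u, t = tbullet u := by
  rcases ty_cases t with ⟨n, rfl⟩ | rfl | ⟨u, v, rfl⟩ | ⟨u, v, rfl⟩ | h
  · exact Or.inl (nb_var n)
  · exact Or.inl nb_nat
  · exact Or.inl (nb_prod _ _)
  · exact Or.inl (nb_arrow _ _)
  · exact Or.inr h

theorem bulletN_nb_inj {n m : ℕ} {u v : PseudoType} (hu : NB u) (hv : NB v)
    (h : tbulletN n u = tbulletN m v) : n = m ∧ u = v := by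
  induction n generalizing m with
  | zero =>
    cases m with
    | zero => exact ⟨rfl, h⟩
    | succ m => rw [bulletN_succ] at h; exact absurd hu ((show u = _ from h) ▸ not_nb_bullet _)
  | succ n ih =>
    cases m with
    | zero => rw [bulletN_succ] at h; exact absurd hv ((show _ = v from h) ▸ not_nb_bullet _)
    | succ m =>
      rw [bulletN_succ, bulletN_succ] at h
      obtain ⟨h1, h2⟩ := ih (bullet_inj h)
      exact ⟨by rw [h1], h2⟩

theorem prod_ne_arrow {a b c d : PseudoType} : tprod a b ≠ tarrow c d := by
  intro h; have := congrArg (fun t => t.dest.1) h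
  simp only [head_prod, head_arrow] at this; cases this
theorem nat_ne_arrow {c d : PseudoType} : tnat ≠ tarrow c d := by
  intro h; have := congrArg (fun t => t.dest.1) h
  simp only [head_nat, head_arrow] at this; cases this
theorem nat_ne_prod {c d : PseudoType} : tnat ≠ tprod c d := by
  intro h; have := congrArg (fun t => t.dest.1) h
  simp only [head_nat, head_prod] at this; cases this

theorem binf_eq : binf = tbullet binf := by
  have h : binf.dest = (tbullet binf).dest := by
    rw [dest_bullet]
    exact PFunctor.M.dest_corec (P := TyP) (fun _ : Unit => ⟨TyHead.bullet, fun _ => ()⟩) ()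
  exact (PFunctor.M.mk_dest binf).symm.trans
    ((congrArg PFunctor.M.mk h).trans (PFunctor.M.mk_dest _))

theorem eq_binf {t : PseudoType} (h : ∀ n u, t = tbulletN n u → ¬ NB u) : t = binf := by
  refine PFunctor.M.bisim (fun a b => b = binf ∧ ∀ n u, a = tbulletN n u → ¬ NB u) ?_ t binf
    ⟨rfl, h⟩
  rintro a b ⟨rfl, ha⟩
  rcases nb_or a with hn | ⟨u, rfl⟩
  · exact absurd hn (ha 0 a rfl)
  · refine ⟨TyHead.bullet, fun _ => u, fun _ => binf, dest_bullet u, ?_, fun _ => ⟨rfl, ?_⟩⟩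
    · conv_lhs => rw [binf_eq]
      exact dest_bullet _
    · intro n v hv
      refine ha (n + 1) v ?_
      rw [bulletN_succ]; exact congrArg tbullet hv

theorem exists_nb {t : PseudoType} (h : t ≠ binf) : ∃ n u, t = tbulletN n u ∧ NB u := by
  by_contra hc
  push Not at hc
  exact h (eq_binf hc)

/-! ### Types -/

theorem IsType.child {t s : PseudoType} (h : IsType t) (hc : Child t s) : IsType s := by
  refine ⟨h.1.subset fun u hu => Relation.ReflTransGen.head hc hu, ?_⟩
  intro f hf0 hf N
  obtain ⟨n, hn, hb⟩ := h.2 (fun n => Nat.casesOn n t f) rfl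
    (by
      intro n
      cases n with
      | zero => show Child t (f 0); rw [hf0]; exact hc
      | succ n => exact hf n) (N + 1)
  cases n with
  | zero => omega
  | succ n => exact ⟨n, by omega, hb⟩

theorem IsType.of_children {t : PseudoType} (hfin : {s | Child t s}.Finite)
    (h : ∀ s, Child t s → IsType s) : IsType t := by
  constructor
  · have : {s | Subtree t s} ⊆ {t} ∪ ⋃ s ∈ {s | Child t s}, {u | Subtree s u} := by
      intro u hu
      rcases Relation.ReflTransGen.cases_head hu with h1 | ⟨c, hc, hcu⟩
      · left; exact h1.symm
      · right; simp only [Set.mem_iUnion]; exact ⟨c, hc, hcu⟩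
    refine Set.Finite.subset ?_ this
    exact (Set.finite_singleton _).union (hfin.biUnion fun s hs => (h s hs).1)
  · intro f hf0 hf N
    have hc : Child t (f 1) := hf0 ▸ hf 0
    obtain ⟨n, hn, hb⟩ := (h _ hc).2 (fun n => f (n + 1)) rfl (fun n => hf (n + 1)) N
    exact ⟨n + 1, by omega, hb⟩

theorem IsType.bullet {t : PseudoType} (h : IsType t) : IsType (tbullet t) := by
  apply IsType.of_children
  · refine (Set.finite_singleton t).subset ?_
    intro s hs; exact child_bullet.1 hs
  · intro s hs; rw [child_bullet.1 hs]; exact h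

theorem IsType.prod {t s : PseudoType} (h : IsType t) (h' : IsType s) : IsType (tprod t s) := by
  apply IsType.of_children
  · refine (Set.toFinite {t, s}).subset ?_
    intro s hs; exact child_prod.1 hs
  · intro s hs
    rcases child_prod.1 hs with rfl | rfl <;> assumption

/-- Non-bullet child relation. -/
def NBC (u t : PseudoType) : Prop := NB t ∧ Child t u

theorem exists_chain {α : Type*} {r : α → α → Prop} {a : α} (h : ¬ Acc r a) :
    ∃ f : ℕ → α, f 0 = a ∧ ∀ n, r (f (n + 1)) (f n) := by
  have hs : ∀ x : {b // ¬ Acc r b}, ∃ y : {b // ¬ Acc r b}, r y.1 x.1 := by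
    rintro ⟨x, hx⟩
    obtain ⟨y, hy, hr⟩ := exists_not_acc_lt_of_not_acc hx
    exact ⟨⟨y, hy⟩, hr⟩
  choose g hg using hs
  refine ⟨fun n => (g^[n] ⟨a, h⟩).1, rfl, fun n => ?_⟩
  simp only [Function.iterate_succ_apply']
  exact hg _

theorem IsType.acc {t : PseudoType} (h : IsType t) : Acc NBC t := by
  by_contra hc
  obtain ⟨f, h0, hf⟩ := exists_chain hc
  obtain ⟨n, _, hb⟩ := h.2 f h0 (fun n => (hf n).2) 0
  exact (hf n).1 hb

/-! ### Tail finiteness -/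

theorem TailFinite.sub {t s : PseudoType} (h : TailFinite t) (hs : Subtree t s) :
    TailFinite s :=
  ⟨fun u hu => h.1 u (hs.trans hu), fun u hu => h.2 u (hs.trans hu)⟩

theorem TailFinite.child {t s : PseudoType} (h : TailFinite t) (hs : Child t s) :
    TailFinite s := h.sub (Relation.ReflTransGen.single hs)

theorem TailFinite.bullet {t : PseudoType} (h : TailFinite t) : TailFinite (tbullet t) := by
  constructor
  · intro u hu
    rcases Relation.ReflTransGen.cases_head hu with rfl | ⟨c, hc, hcu⟩
    · intro hb
      rw [binf_eq] at hb
      exact h.1 t Relation.ReflTransGen.refl (bullet_inj hb)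
    · rw [child_bullet.1 hc] at hcu
      exact h.1 u hcu
  · intro u hu
    rcases Relation.ReflTransGen.cases_head hu with rfl | ⟨c, hc, hcu⟩
    · rintro ⟨f, h0, hf⟩
      apply h.2 t Relation.ReflTransGen.refl
      refine ⟨fun n => Nat.casesOn n t (fun k => f (k + 1)), rfl, ?_⟩
      intro n
      cases n with
      | zero =>
        obtain ⟨n, t₁, hn⟩ := hf 0
        rw [h0] at hn
        cases n with
        | zero => exact absurd (hn ▸ nb_arrow _ _ : NB (tbullet t)) (not_nb_bullet _)
        | succ n => rw [bulletN_succ] at hn; exact ⟨n, t₁, bullet_inj hn⟩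
      | succ n => exact hf (n + 1)
    · rw [child_bullet.1 hc] at hcu
      exact h.2 u hcu

theorem tf_bulletN {n : ℕ} {t : PseudoType} : TailFinite (tbulletN n t) ↔ TailFinite t := by
  induction n with
  | zero => rfl
  | succ n ih =>
    rw [bulletN_succ, ← ih]
    exact ⟨fun h => h.child (child_bullet.2 rfl), fun h => h.bullet⟩

theorem tf_nat : TailFinite tnat := by
  have hs : ∀ u, Subtree tnat u → u = tnat := by
    intro u hu
    rcases Relation.ReflTransGen.cases_head hu with rfl | ⟨c, hc, hcu⟩
    · rfl
    · exact absurd hc child_nat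
  constructor
  · intro u hu hb
    rw [hs u hu, binf_eq] at hb
    exact not_nb_bullet _ (hb ▸ nb_nat)
  · intro u hu
    rw [hs u hu]
    rintro ⟨f, h0, hf⟩
    obtain ⟨n, t₁, hn⟩ := hf 0
    rw [h0] at hn
    have := bulletN_nb_inj (n := 0) nb_nat (nb_arrow _ _) hn
    exact nat_ne_arrow this.2

/-! ### Reduction -/

theorem Red.app {a b : Expr} (h : Red a b) (c : Expr) : Red (.app a c) (.app b c) := by
  obtain ⟨E, e, f, hr, rfl, rfl⟩ := h
  exact ⟨.app E c, e, f, hr, rfl, rfl⟩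
theorem Red.fst {a b : Expr} (h : Red a b) :
    Red (.app (.const .cfst) a) (.app (.const .cfst) b) := by
  obtain ⟨E, e, f, hr, rfl, rfl⟩ := h
  exact ⟨.fst E, e, f, hr, rfl, rfl⟩
theorem Red.snd {a b : Expr} (h : Red a b) :
    Red (.app (.const .csnd) a) (.app (.const .csnd) b) := by
  obtain ⟨E, e, f, hr, rfl, rfl⟩ := h
  exact ⟨.snd E, e, f, hr, rfl, rfl⟩
theorem Red.succ {a b : Expr} (h : Red a b) :
    Red (.app (.const .succ) a) (.app (.const .succ) b) := by
  obtain ⟨E, e, f, hr, rfl, rfl⟩ := h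
  exact ⟨.succ E, e, f, hr, rfl, rfl⟩
theorem Red.head {a b : Expr} (h : HeadRed a b) : Red a b := ⟨.hole, a, b, h, rfl, rfl⟩

theorem RedStar.app {a b : Expr} (h : RedStar a b) (c : Expr) :
    RedStar (.app a c) (.app b c) := by
  induction h with
  | refl => exact Relation.ReflTransGen.refl
  | tail _ h ih => exact ih.tail (h.app c)
theorem RedStar.fst {a b : Expr} (h : RedStar a b) :
    RedStar (.app (.const .cfst) a) (.app (.const .cfst) b) := by
  induction h with
  | refl => exact Relation.ReflTransGen.refl
  | tail _ h ih => exact ih.tail (h.fst)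
theorem RedStar.snd {a b : Expr} (h : RedStar a b) :
    RedStar (.app (.const .csnd) a) (.app (.const .csnd) b) := by
  induction h with
  | refl => exact Relation.ReflTransGen.refl
  | tail _ h ih => exact ih.tail (h.snd)
theorem RedStar.succ {a b : Expr} (h : RedStar a b) :
    RedStar (.app (.const .succ) a) (.app (.const .succ) b) := by
  induction h with
  | refl => exact Relation.ReflTransGen.refl
  | tail _ h ih => exact ih.tail (h.succ)

theorem nf_var (x : ℕ) : NormalForm (.var x) := by
  rintro f ⟨E, e, g, hr, h, -⟩
  cases E <;> simp only [ECtx.plug] at h <;> cases h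
  cases hr
theorem nf_const (k : Const) : NormalForm (.const k) := by
  rintro f ⟨E, e, g, hr, h, -⟩
  cases E <;> simp only [ECtx.plug] at h <;> cases h
  cases hr
theorem nf_lam (b : Expr) : NormalForm (.lam b) := by
  rintro f ⟨E, e, g, hr, h, -⟩
  cases E <;> simp only [ECtx.plug] at h <;> cases h
  cases hr

theorem nf_app {a b : Expr} (ha : NormalForm a) (hl : ∀ c, a ≠ .lam c)
    (h1 : a = .const .cfst → NormalForm b ∧ ∀ c d, b ≠ mkPair c d)
    (h2 : a = .const .csnd → NormalForm b ∧ ∀ c d, b ≠ mkPair c d)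
    (h3 : a = .const .succ → NormalForm b) : NormalForm (.app a b) := by
  rintro f ⟨E, e, g, hr, h, -⟩
  cases E with
  | hole =>
    simp only [ECtx.plug] at h
    subst h
    cases hr with
    | beta => exact hl _ rfl
    | fst => exact (h1 rfl).2 _ _ rfl
    | snd => exact (h2 rfl).2 _ _ rfl
  | app E c =>
    simp only [ECtx.plug] at h
    cases h
    exact ha _ ⟨E, e, g, hr, rfl, rfl⟩
  | fst E =>
    simp only [ECtx.plug] at h
    cases h
    exact (h1 rfl).1 _ ⟨E, e, g, hr, rfl, rfl⟩
  | snd E =>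
    simp only [ECtx.plug] at h
    cases h
    exact (h2 rfl).1 _ ⟨E, e, g, hr, rfl, rfl⟩
  | succ E =>
    simp only [ECtx.plug] at h
    cases h
    exact h3 rfl _ ⟨E, e, g, hr, rfl, rfl⟩

/-- Neutral expressions. -/
inductive Neu : Expr → Prop
  | var (x) : Neu (.var x)
  | app {n} (a) : Neu n → Neu (.app n a)
  | fst {n} : Neu n → Neu (.app (.const .cfst) n)
  | snd {n} : Neu n → Neu (.app (.const .csnd) n)

theorem Neu.ne_lam {e c : Expr} (h : Neu e) : e ≠ .lam c := by rintro rfl; cases h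
theorem Neu.ne_const {e : Expr} {c} (h : Neu e) : e ≠ .const c := by rintro rfl; cases h
theorem Neu.ne_pair {e c d : Expr} (h : Neu e) : e ≠ mkPair c d := by
  rintro rfl
  cases h with
  | app _ h => cases h with
    | app _ h => cases h

theorem Neu.nf {e : Expr} (h : Neu e) : NormalForm e := by
  induction h with
  | var x => exact nf_var x
  | app a h ih =>
    exact nf_app ih (fun c => h.ne_lam) (fun hc => absurd hc h.ne_const)
      (fun hc => absurd hc h.ne_const) (fun hc => absurd hc h.ne_const)
  | fst h ih =>
    exact nf_app (nf_const _) (by simp) (fun _ => ⟨ih, fun _ _ => h.ne_pair⟩) (by simp) (by simp)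
  | snd h ih =>
    exact nf_app (nf_const _) (by simp) (by simp) (fun _ => ⟨ih, fun _ _ => h.ne_pair⟩) (by simp)

theorem nf_pair1 (a : Expr) : NormalForm (.app (.const .pair) a) :=
  nf_app (nf_const _) (by simp) (by simp) (by simp) (by simp)
theorem nf_pair2 (a b : Expr) : NormalForm (mkPair a b) :=
  nf_app (nf_pair1 _) (by simp) (by simp) (by simp) (by simp)

theorem HasWhnf.of_nf {e : Expr} (h : NormalForm e) : HasWhnf e :=
  ⟨e, Relation.ReflTransGen.refl, h⟩
theorem HasWhnf.exp {e f : Expr} (hr : RedStar e f) (h : HasWhnf f) : HasWhnf e := by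
  obtain ⟨g, h1, h2⟩ := h
  exact ⟨g, hr.trans h1, h2⟩

/-! ### Syntactic metatheory: renaming, substitution, inversion, subject reduction -/

theorem Types.bulletsI {Γ : Ctx} {e t} (n : ℕ) (h : Types Γ e t) : Types Γ e (tbulletN n t) := by
  induction n with
  | zero => exact h
  | succ n ih => rw [bulletN_succ]; exact .bulletI ih

theorem Types.ren {Γ : Ctx} {e t} (h : Types Γ e t) : ∀ {Δ : Ctx} {f : ℕ → ℕ},
    (∀ x s, Γ x = some s → Δ (f x) = some s) → Types Δ (rename f e) t := by
  induction h with
  | ax hx ht => intro Δ f hf; exact .ax (hf _ _ hx) ht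
  | const hk => intro Δ f hf; exact .const hk
  | bulletI _ ih => intro Δ f hf; exact .bulletI (ih hf)
  | arrowI _ ih =>
    intro Δ f hf
    refine .arrowI (ih ?_)
    intro x s hx
    cases x with
    | zero => exact hx
    | succ x => exact hf x s hx
  | arrowE _ _ ih1 ih2 => intro Δ f hf; exact .arrowE (ih1 hf) (ih2 hf)

theorem Types.sub {Γ : Ctx} {e t} (h : Types Γ e t) : ∀ {Δ : Ctx} {ρ : ℕ → Expr},
    (∀ x s, Γ x = some s → IsType s → Types Δ (ρ x) s) → Types Δ (substE ρ e) t := by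
  induction h with
  | ax hx ht => intro Δ f hf; exact hf _ _ hx ht
  | const hk => intro Δ f hf; exact .const hk
  | bulletI _ ih => intro Δ f hf; exact .bulletI (ih hf)
  | arrowI _ ih =>
    intro Δ f hf
    refine .arrowI (ih ?_)
    intro x s hx hs
    cases x with
    | zero => exact .ax hx hs
    | succ x => exact (hf x s hx hs).ren (fun _ _ h => h)
  | arrowE _ _ ih1 ih2 => intro Δ f hf; exact .arrowE (ih1 hf) (ih2 hf)

/-- Delaying: some of the variables of the context may be delayed if the result is. -/
theorem Types.delay {Γ : Ctx} {e t} (h : Types Γ e t) : ∀ {Δ : Ctx},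
    (∀ x s, Γ x = some s → Δ x = some s ∨ Δ x = some (tbullet s)) → Types Δ e (tbullet t) := by
  induction h with
  | ax hx ht =>
    intro Δ hf
    rcases hf _ _ hx with h | h
    · exact .bulletI (.ax h ht)
    · exact .ax h ht.bullet
  | const hk => intro Δ hf; exact .bulletI (.const hk)
  | bulletI _ ih => intro Δ hf; exact .bulletI (ih hf)
  | @arrowI Γ e n t s _ ih =>
    intro Δ hf
    rw [← bulletN_succ]
    refine .arrowI ?_
    rw [bulletN_succ n s]
    refine ih ?_
    intro x u hx
    cases x with
    | zero =>
      right
      cases hx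
      show some _ = _
      rw [bulletN_succ]
    | succ x => exact hf x u hx
  | arrowE _ _ ih1 ih2 =>
    intro Δ hf
    rw [← bulletN_succ]
    have h1 := ih1 hf
    have h2 := ih2 hf
    rw [← bulletN_succ] at h1 h2
    exact .arrowE h1 h2

theorem inv_lam {Γ : Ctx} {e t} (h : Types Γ (.lam e) t) :
    ∃ n t₁ s, t = tbulletN n (tarrow t₁ s) ∧
      Types (Ctx.cons (tbulletN n t₁) Γ) e (tbulletN n s) := by
  generalize he : Expr.lam e = e' at h
  induction h with
  | ax => cases he
  | const => cases he
  | bulletI _ ih =>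
    obtain ⟨n, t₁, s, rfl, h⟩ := ih he
    refine ⟨n + 1, t₁, s, (bulletN_succ _ _).symm, ?_⟩
    rw [bulletN_succ n s]
    refine h.delay ?_
    intro x u hx
    cases x with
    | zero =>
      right
      cases hx
      show some _ = _
      rw [bulletN_succ]
    | succ x => left; exact hx
  | arrowI h _ => cases he; exact ⟨_, _, _, rfl, h⟩
  | arrowE => cases he

theorem inv_app {Γ : Ctx} {a b t} (h : Types Γ (.app a b) t) :
    ∃ n t₁ s, t = tbulletN n s ∧ Types Γ a (tbulletN n (tarrow t₁ s)) ∧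
      Types Γ b (tbulletN n t₁) := by
  generalize he : Expr.app a b = e' at h
  induction h with
  | ax => cases he
  | const => cases he
  | bulletI _ ih =>
    obtain ⟨n, t₁, s, rfl, h1, h2⟩ := ih he
    refine ⟨n + 1, t₁, s, (bulletN_succ _ _).symm, ?_, ?_⟩
    · rw [bulletN_succ]; exact .bulletI h1
    · rw [bulletN_succ]; exact .bulletI h2
  | arrowI => cases he
  | arrowE h1 h2 => cases he; exact ⟨_, _, _, rfl, h1, h2⟩

theorem inv_const {Γ : Ctx} {k t} (h : Types Γ (.const k) t) :
    ∃ n u, t = tbulletN n u ∧ KappaTy k u := by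
  generalize he : Expr.const k = e' at h
  induction h with
  | ax => cases he
  | const h => cases he; exact ⟨0, _, rfl, h⟩
  | bulletI _ ih =>
    obtain ⟨n, u, rfl, h⟩ := ih he
    exact ⟨n + 1, u, (bulletN_succ _ _).symm, h⟩
  | arrowI => cases he
  | arrowE => cases he

theorem inv_var {Γ : Ctx} {x t} (h : Types Γ (.var x) t) :
    ∃ n u, t = tbulletN n u ∧ Γ x = some u := by
  generalize he : Expr.var x = e' at h
  induction h with
  | ax h => cases he; exact ⟨0, _, rfl, h⟩
  | const => cases he
  | bulletI _ ih =>
    obtain ⟨n, u, rfl, h⟩ := ih he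
    exact ⟨n + 1, u, (bulletN_succ _ _).symm, h⟩
  | arrowI => cases he
  | arrowE => cases he

theorem inv_fst {Γ : Ctx} {a t} (h : Types Γ (.app (.const .cfst) a) t) :
    ∃ n u v, t = tbulletN n u ∧ Types Γ a (tbulletN n (tprod u v)) := by
  obtain ⟨n, t₁, s, rfl, h1, h2⟩ := inv_app h
  obtain ⟨m, u, hu, hk⟩ := inv_const h1
  cases hk
  obtain ⟨rfl, h3⟩ := bulletN_nb_inj (nb_arrow _ _) (nb_arrow _ _) hu
  obtain ⟨rfl, rfl⟩ := arrow_inj h3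
  exact ⟨_, _, _, rfl, h2⟩

theorem inv_snd {Γ : Ctx} {a t} (h : Types Γ (.app (.const .csnd) a) t) :
    ∃ n u v, t = tbulletN n v ∧ Types Γ a (tbulletN n (tprod u v)) := by
  obtain ⟨n, t₁, s, rfl, h1, h2⟩ := inv_app h
  obtain ⟨m, u, hu, hk⟩ := inv_const h1
  cases hk
  obtain ⟨rfl, h3⟩ := bulletN_nb_inj (nb_arrow _ _) (nb_arrow _ _) hu
  obtain ⟨rfl, rfl⟩ := arrow_inj h3
  exact ⟨_, _, _, rfl, h2⟩

theorem inv_succ {Γ : Ctx} {a t} (h : Types Γ (.app (.const .succ) a) t) :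
    ∃ n, t = tbulletN n tnat ∧ Types Γ a (tbulletN n tnat) := by
  obtain ⟨n, t₁, s, rfl, h1, h2⟩ := inv_app h
  obtain ⟨m, u, hu, hk⟩ := inv_const h1
  cases hk
  obtain ⟨rfl, h3⟩ := bulletN_nb_inj (nb_arrow _ _) (nb_arrow _ _) hu
  obtain ⟨rfl, rfl⟩ := arrow_inj h3
  exact ⟨_, rfl, h2⟩

theorem inv_pair1 {Γ : Ctx} {a t} (h : Types Γ (.app (.const .pair) a) t) :
    ∃ n u v, t = tbulletN n (tarrow v (tprod u v)) ∧ Types Γ a (tbulletN n u) := by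
  obtain ⟨n, t₁, s, rfl, h1, h2⟩ := inv_app h
  obtain ⟨m, u, hu, hk⟩ := inv_const h1
  cases hk
  obtain ⟨rfl, h3⟩ := bulletN_nb_inj (nb_arrow _ _) (nb_arrow _ _) hu
  obtain ⟨rfl, rfl⟩ := arrow_inj h3
  exact ⟨_, _, _, rfl, h2⟩

theorem inv_pair2 {Γ : Ctx} {a b t} (h : Types Γ (mkPair a b) t) :
    ∃ n u v, t = tbulletN n (tprod u v) ∧ Types Γ a (tbulletN n u) ∧
      Types Γ b (tbulletN n v) := by
  obtain ⟨n, t₁, s, rfl, h1, h2⟩ := inv_app h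
  obtain ⟨m, u, v, hu, h3⟩ := inv_pair1 h1
  obtain ⟨rfl, h4⟩ := bulletN_nb_inj (nb_arrow _ _) (nb_arrow _ _) hu
  obtain ⟨rfl, rfl⟩ := arrow_inj h4
  exact ⟨_, _, _, rfl, h3, h2⟩

theorem HeadRed.types {Γ : Ctx} {a b t} (hr : HeadRed a b) (h : Types Γ a t) : Types Γ b t := by
  cases hr with
  | beta e f =>
    obtain ⟨n, t₁, s, rfl, h1, h2⟩ := inv_app h
    obtain ⟨m, t₂, s₂, he, h3⟩ := inv_lam h1
    obtain ⟨rfl, h4⟩ := bulletN_nb_inj (nb_arrow _ _) (nb_arrow _ _) he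
    obtain ⟨rfl, rfl⟩ := arrow_inj h4
    refine h3.sub ?_
    intro x u hx hu
    cases x with
    | zero => cases hx; exact h2
    | succ x => exact .ax hx hu
  | fst e₁ e₂ =>
    obtain ⟨n, u, v, rfl, h1⟩ := inv_fst h
    obtain ⟨m, u', v', he, h2, h3⟩ := inv_pair2 h1
    obtain ⟨rfl, h4⟩ := bulletN_nb_inj (nb_prod _ _) (nb_prod _ _) he
    obtain ⟨rfl, rfl⟩ := prod_inj h4
    exact h2
  | snd e₁ e₂ =>
    obtain ⟨n, u, v, rfl, h1⟩ := inv_snd h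
    obtain ⟨m, u', v', he, h2, h3⟩ := inv_pair2 h1
    obtain ⟨rfl, h4⟩ := bulletN_nb_inj (nb_prod _ _) (nb_prod _ _) he
    obtain ⟨rfl, rfl⟩ := prod_inj h4
    exact h3

theorem Red.types {Γ : Ctx} {a b t} (hr : Red a b) (h : Types Γ a t) : Types Γ b t := by
  obtain ⟨E, e, f, hr, rfl, rfl⟩ := hr
  induction E generalizing t with
  | hole => exact hr.types h
  | app E c ih =>
    obtain ⟨n, t₁, s, rfl, h1, h2⟩ := inv_app h
    exact .arrowE (ih h1) h2
  | fst E ih =>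
    obtain ⟨n, t₁, s, rfl, h1, h2⟩ := inv_app h
    exact .arrowE h1 (ih h2)
  | snd E ih =>
    obtain ⟨n, t₁, s, rfl, h1, h2⟩ := inv_app h
    exact .arrowE h1 (ih h2)
  | succ E ih =>
    obtain ⟨n, t₁, s, rfl, h1, h2⟩ := inv_app h
    exact .arrowE h1 (ih h2)

theorem RedStar.types {Γ : Ctx} {a b t} (hr : RedStar a b) (h : Types Γ a t) : Types Γ b t := by
  induction hr with
  | refl => exact h
  | tail _ h1 ih => exact h1.types ih

/-! ### Substitution algebra -/

theorem rename_eq_subst (f : ℕ → ℕ) (e : Expr) : rename f e = substE (fun n => .var (f n)) e := by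
  induction e generalizing f with
  | var x => rfl
  | const k => rfl
  | lam e ih =>
    simp only [rename, substE]
    rw [ih]
    congr 2
    funext n
    cases n <;> rfl
  | app a b ih1 ih2 => simp only [rename, substE, ih1, ih2]

theorem subst_rename (ρ : ℕ → Expr) (f : ℕ → ℕ) (e : Expr) :
    substE ρ (rename f e) = substE (fun n => ρ (f n)) e := by
  induction e generalizing f ρ with
  | var x => rfl
  | const k => rfl
  | lam e ih =>
    simp only [rename, substE]
    rw [ih]
    congr 2
    funext n
    cases n <;> rfl
  | app a b ih1 ih2 => simp only [rename, substE, ih1, ih2]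

theorem rename_rename (g f : ℕ → ℕ) (e : Expr) :
    rename g (rename f e) = rename (fun n => g (f n)) e := by
  rw [rename_eq_subst, subst_rename, ← rename_eq_subst (fun n => g (f n))]

theorem rename_subst (ρ : ℕ → Expr) (f : ℕ → ℕ) (e : Expr) :
    rename f (substE ρ e) = substE (fun n => rename f (ρ n)) e := by
  induction e generalizing f ρ with
  | var x => rfl
  | const k => rfl
  | lam e ih =>
    simp only [rename, substE]
    rw [ih]
    congr 2
    funext n
    cases n with
    | zero => rfl
    | succ n =>
      simp only [liftSub]
      rw [rename_rename, rename_rename]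
      rfl
  | app a b ih1 ih2 => simp only [rename, substE, ih1, ih2]

theorem subst_subst (σ ρ : ℕ → Expr) (e : Expr) :
    substE σ (substE ρ e) = substE (fun n => substE σ (ρ n)) e := by
  induction e generalizing σ ρ with
  | var x => rfl
  | const k => rfl
  | lam e ih =>
    simp only [substE]
    rw [ih]
    congr 2
    funext n
    cases n with
    | zero => rfl
    | succ n =>
      simp only [liftSub]
      rw [subst_rename, rename_subst]
      rfl
  | app a b ih1 ih2 => simp only [substE, ih1, ih2]

theorem subst_id (e : Expr) : substE .var e = e := by
  induction e with
  | var x => rfl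
  | const k => rfl
  | lam e ih =>
    simp only [substE]
    have : liftSub .var = Expr.var := by
      funext n
      cases n <;> rfl
    rw [this, ih]
  | app a b ih1 ih2 => simp only [substE, ih1, ih2]

/-- Extending a substitution. -/
def consS (a : Expr) (ρ : ℕ → Expr) : ℕ → Expr
  | 0 => a
  | n + 1 => ρ n

theorem subst0_lift (ρ : ℕ → Expr) (e a : Expr) :
    subst0 (substE (liftSub ρ) e) a = substE (consS a ρ) e := by
  unfold subst0
  rw [subst_subst]
  congr 1
  funext n
  cases n with
  | zero => rfl
  | succ n =>
    simp only [liftSub]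
    rw [subst_rename]
    exact subst_id _

/-! ### Indexed interpretation of types -/

/-- The non-bullet child relation, restricted to its accessible part. -/
def NBR (u t : PseudoType) : Prop := NBC u t ∧ Acc NBC t

theorem nbr_wf : WellFounded NBR := by
  constructor
  intro t
  by_cases h : Acc NBC t
  · induction h with
    | intro t _ ih => exact ⟨_, fun u hu => ih u hu.1⟩
  · exact ⟨_, fun u hu => absurd hu.2 h⟩

theorem nbc_prod1 {t u v : PseudoType} (h : t = tprod u v) : NBC u t :=
  h ▸ ⟨nb_prod _ _, child_prod.2 (Or.inl rfl)⟩
theorem nbc_prod2 {t u v : PseudoType} (h : t = tprod u v) : NBC v t :=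
  h ▸ ⟨nb_prod _ _, child_prod.2 (Or.inr rfl)⟩
theorem nbc_arrow1 {t u v : PseudoType} (h : t = tarrow u v) : NBC u t :=
  h ▸ ⟨nb_arrow _ _, child_arrow.2 (Or.inl rfl)⟩
theorem nbc_arrow2 {t u v : PseudoType} (h : t = tarrow u v) : NBC v t :=
  h ▸ ⟨nb_arrow _ _, child_arrow.2 (Or.inr rfl)⟩

/-- The interpretation at the successor index, given that at the previous index. -/
noncomputable def interpStep (P : PseudoType → Expr → Prop) : PseudoType → Expr → Prop :=
  nbr_wf.fix fun t rec e => ∀ hA : Acc NBC t,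
    (∀ u, t = tbullet u → P u e) ∧
    (NB t → HasWhnf e) ∧
    (∀ u v, ∀ h : t = tprod u v, ∃ f, RedStar e f ∧ (Neu f ∨ ∃ a b, f = mkPair a b ∧
      rec u ⟨nbc_prod1 h, hA⟩ a ∧ rec v ⟨nbc_prod2 h, hA⟩ b)) ∧
    (∀ u v, ∀ h : t = tarrow u v, P t e ∧ ∀ a, rec u ⟨nbc_arrow1 h, hA⟩ a →
      rec v ⟨nbc_arrow2 h, hA⟩ (.app e a))

theorem interpStep_iff (P : PseudoType → Expr → Prop) (t : PseudoType) (e : Expr) :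
    interpStep P t e ↔ (Acc NBC t →
    (∀ u, t = tbullet u → P u e) ∧
    (NB t → HasWhnf e) ∧
    (∀ u v, t = tprod u v → ∃ f, RedStar e f ∧ (Neu f ∨ ∃ a b, f = mkPair a b ∧
      interpStep P u a ∧ interpStep P v b)) ∧
    (∀ u v, t = tarrow u v → P t e ∧ ∀ a, interpStep P u a →
      interpStep P v (.app e a))) := by
  conv_lhs => unfold interpStep; rw [WellFounded.fix_eq]
  rfl

/-- The indexed interpretation of types. -/
noncomputable def interp : ℕ → PseudoType → Expr → Prop
  | 0 => fun _ _ => True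
  | i + 1 => interpStep (interp i)

theorem interp_zero (t e) : interp 0 t e := trivial

theorem interp_bullet (i t e) : interp (i + 1) (tbullet t) e ↔ interp i t e := by
  show interpStep _ _ _ ↔ _
  rw [interpStep_iff]
  constructor
  · intro h
    exact (h ⟨_, fun u hu => absurd hu.1 (not_nb_bullet _)⟩).1 t rfl
  · intro h _
    refine ⟨fun u hu => bullet_inj hu ▸ h, fun hn => absurd hn (not_nb_bullet _), ?_, ?_⟩
    · intro u v hu; exact absurd (hu ▸ nb_prod u v) (not_nb_bullet _)
    · intro u v hu; exact absurd (hu ▸ nb_arrow u v) (not_nb_bullet _)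

theorem interp_exp {i t e f} (hr : RedStar e f) (h : interp i t f) : interp i t e := by
  induction i generalizing t e f with
  | zero => trivial
  | succ i ih =>
    induction t using nbr_wf.induction generalizing e f with
    | _ t iht =>
      have h := (interpStep_iff _ _ _).1 h
      refine (interpStep_iff _ _ _).2 fun hA => ?_
      obtain ⟨h1, h2, h3, h4⟩ := h hA
      refine ⟨fun u hu => ih hr (h1 u hu), fun hn => (h2 hn).exp hr, ?_, ?_⟩
      · intro u v hu
        obtain ⟨g, hg, h5⟩ := h3 u v hu
        exact ⟨g, hr.trans hg, h5⟩
      · intro u v hu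
        exact ⟨ih hr (h4 u v hu).1, fun a ha =>
          iht v ⟨nbc_arrow2 hu, hA⟩ (hr.app a) ((h4 u v hu).2 a ha)⟩

theorem interp_neu {i t e} (he : Neu e) : interp i t e := by
  induction i generalizing t e with
  | zero => trivial
  | succ i ih =>
    induction t using nbr_wf.induction generalizing e with
    | _ t iht =>
      refine (interpStep_iff _ _ _).2 fun hA => ?_
      refine ⟨fun u hu => ih he, fun hn => .of_nf he.nf, ?_, ?_⟩
      · intro u v hu
        exact ⟨e, Relation.ReflTransGen.refl, Or.inl he⟩
      · intro u v hu
        exact ⟨ih he, fun a ha => iht v ⟨nbc_arrow2 hu, hA⟩ (.app a he)⟩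

theorem interp_mono1 {i t e} (h : interp (i + 1) t e) : interp i t e := by
  induction i generalizing t e with
  | zero => trivial
  | succ i ih =>
    induction t using nbr_wf.induction generalizing e with
    | _ t iht =>
      have h := (interpStep_iff _ _ _).1 h
      by_cases hA : Acc NBC t
      · obtain ⟨h1, h2, h3, h4⟩ := h hA
        rcases ty_cases t with ⟨n, rfl⟩ | rfl | ⟨u, v, rfl⟩ | ⟨u, v, rfl⟩ | ⟨u, rfl⟩
        · refine (interpStep_iff _ _ _).2 fun _ => ⟨fun u hu => ?_, h2, fun u v hu => ?_,
            fun u v hu => ?_⟩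
          · exact absurd (hu ▸ nb_var n) (not_nb_bullet _)
          · have := congrArg (fun t => t.dest.1) hu
            simp only [head_prod, head_var] at this; cases this
          · have := congrArg (fun t => t.dest.1) hu
            simp only [head_arrow, head_var] at this; cases this
        · refine (interpStep_iff _ _ _).2 fun _ => ⟨fun u hu => ?_, h2, fun u v hu => ?_,
            fun u v hu => ?_⟩
          · exact absurd (hu ▸ nb_nat) (not_nb_bullet _)
          · exact absurd hu nat_ne_prod
          · exact absurd hu nat_ne_arrow
        · refine (interpStep_iff _ _ _).2 fun _ => ⟨fun w hu => ?_, h2, fun u' v' hu => ?_,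
            fun u' v' hu => absurd hu prod_ne_arrow⟩
          · exact absurd (hu ▸ nb_prod u v) (not_nb_bullet _)
          · obtain ⟨g, hg, h5⟩ := h3 u' v' hu
            refine ⟨g, hg, ?_⟩
            rcases h5 with h5 | ⟨a, b, h5, h6, h7⟩
            · exact Or.inl h5
            · exact Or.inr ⟨a, b, h5, iht u' ⟨nbc_prod1 hu, hA⟩ h6,
                iht v' ⟨nbc_prod2 hu, hA⟩ h7⟩
        · exact (h4 u v rfl).1
        · exact (interp_bullet _ _ _).2 (ih (h1 u rfl))
      · exact (interpStep_iff _ _ _).2 fun h => absurd h hA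

theorem interp_mono {i j t e} (hij : j ≤ i) (h : interp i t e) : interp j t e := by
  induction hij with
  | refl => exact h
  | step _ ih => exact ih (interp_mono1 h)

theorem interp_bulletN (n i t e) : interp i (tbulletN n t) e ↔ interp (i - n) t e := by
  induction n generalizing i with
  | zero => rfl
  | succ n ih =>
    rw [bulletN_succ]
    cases i with
    | zero => simp [interp]
    | succ i => rw [interp_bullet, ih, Nat.add_sub_add_right]

/-- Interpretation used for the subject of a judgement: it makes sense for all
pseudo-types that can be assigned to expressions. -/
inductive Sem : ℕ → PseudoType → Expr → Prop
  | base {i t e} : IsType t → interp i t e → Sem i t e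
  | zero {t e} : Sem 0 t e
  | bul {i t e} : Sem i t e → Sem (i + 1) (tbullet t) e
  | arr {i t s e} : HasWhnf e →
      (∀ j, j ≤ i → ∀ a, interp j t a → Sem j s (.app e a)) → Sem i (tarrow t s) e

theorem Sem.interp {i t e} (h : Sem i t e) : interp i t e := by
  induction h with
  | base _ h => exact h
  | zero => trivial
  | bul _ ih => exact (interp_bullet _ _ _).2 ih
  | @arr i t s e hw _ ih =>
    have : ∀ k, k ≤ i → LambdaBullet.interp k (tarrow t s) e := by
      intro k
      induction k with
      | zero => intro _; trivial
      | succ k ihk =>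
        intro hk
        refine (interpStep_iff _ _ _).2 fun hA => ⟨fun w hu => ?_, fun _ => hw,
          fun u' v' hu => absurd hu.symm prod_ne_arrow, fun u' v' hu => ?_⟩
        · exact absurd (hu ▸ nb_arrow t s) (not_nb_bullet _)
        · obtain ⟨rfl, rfl⟩ := arrow_inj hu
          exact ⟨ihk (by omega), fun a ha => ih (k + 1) hk a ha⟩
    exact this i le_rfl

theorem Sem.mono {i j t e} (hij : j ≤ i) (h : Sem i t e) : Sem j t e := by
  induction h generalizing j with
  | base ht h => exact .base ht (interp_mono hij h)
  | zero => rw [Nat.le_zero.1 hij]; exact .zero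
  | bul _ ih =>
    cases j with
    | zero => exact .zero
    | succ j => exact .bul (ih (by omega))
  | arr hw h _ => exact .arr hw fun k hk => h k (hk.trans hij)

theorem Sem.exp {i t e f} (hr : RedStar e f) (h : Sem i t f) : Sem i t e := by
  induction h generalizing e with
  | base ht h => exact .base ht (interp_exp hr h)
  | zero => exact .zero
  | bul _ ih => exact .bul (ih hr)
  | arr hw h ih => exact .arr (hw.exp hr) fun k hk a ha => ih k hk a ha (hr.app a)

theorem sem_bullet (i t e) : Sem (i + 1) (tbullet t) e ↔ Sem i t e := by
  refine ⟨fun h => ?_, .bul⟩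
  generalize hu : tbullet t = u at h
  generalize hj : i + 1 = j at h
  cases h with
  | base ht h =>
    subst hu hj
    exact .base (ht.child (child_bullet.2 rfl)) ((interp_bullet _ _ _).1 h)
  | zero => omega
  | bul h =>
    rw [bullet_inj hu]
    cases hj
    exact h
  | arr => exact absurd (hu ▸ nb_arrow _ _) (not_nb_bullet t)

theorem sem_bulletN (n i t e) : Sem i (tbulletN n t) e ↔ Sem (i - n) t e := by
  induction n generalizing i with
  | zero => rfl
  | succ n ih =>
    rw [bulletN_succ]
    cases i with
    | zero => simp only [Nat.zero_sub]; exact ⟨fun _ => .zero, fun _ => .zero⟩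
    | succ i => rw [sem_bullet, ih, Nat.add_sub_add_right]

theorem Sem.app {i t s e a} (h : Sem i (tarrow t s) e) (ha : LambdaBullet.interp i t a) :
    Sem i s (.app e a) := by
  generalize hu : tarrow t s = u at h
  cases h with
  | base ht h =>
    subst hu
    cases i with
    | zero => exact .zero
    | succ i =>
      obtain ⟨-, -, -, h4⟩ := (interpStep_iff _ _ _).1 h ht.acc
      exact .base (ht.child (child_arrow.2 (Or.inr rfl))) ((h4 t s rfl).2 a ha)
  | zero => exact .zero
  | bul h => exact absurd (hu ▸ nb_arrow _ _) (not_nb_bullet _)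
  | arr hw h =>
    obtain ⟨rfl, rfl⟩ := arrow_inj hu
    exact h i le_rfl a ha

theorem Sem.whnf {i t e} (h : Sem (i + 1) t e) (ht : NB t) : HasWhnf e := by
  generalize hj : i + 1 = j at h
  cases h with
  | base hT h =>
    subst hj
    exact ((interpStep_iff _ _ _).1 h hT.acc).2.1 ht
  | zero => omega
  | bul h => exact absurd ht (not_nb_bullet _)
  | arr hw h => exact hw

theorem interp_prod_inv {i t s e} (ht : IsType t) (hs : IsType s)
    (h : interp (i + 1) (tprod t s) e) :
    ∃ f, RedStar e f ∧ (Neu f ∨ ∃ a b, f = mkPair a b ∧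
      interp (i + 1) t a ∧ interp (i + 1) s b) :=
  ((interpStep_iff _ _ _).1 h (ht.prod hs).acc).2.2.1 t s rfl

theorem interp_pair {i t s a b} (ha : interp i t a) (hb : interp i s b) :
    interp i (tprod t s) (mkPair a b) := by
  cases i with
  | zero => trivial
  | succ i =>
    refine (interpStep_iff _ _ _).2 fun _ => ⟨fun w hu => ?_, fun _ => .of_nf (nf_pair2 _ _),
      fun u' v' hu => ?_, fun u' v' hu => absurd hu prod_ne_arrow⟩
    · exact absurd (hu ▸ nb_prod t s) (not_nb_bullet _)
    · obtain ⟨rfl, rfl⟩ := prod_inj hu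
      exact ⟨_, Relation.ReflTransGen.refl, Or.inr ⟨a, b, rfl, ha, hb⟩⟩

theorem isType_nat : IsType tnat :=
  IsType.of_children (Set.finite_empty.subset fun _ h => child_nat h)
    fun _ h => absurd h child_nat

theorem interp_nat {i e} (h : HasWhnf e) : interp i tnat e := by
  cases i with
  | zero => trivial
  | succ i =>
    refine (interpStep_iff _ _ _).2 fun _ => ⟨fun w hu => ?_, fun _ => h,
      fun u' v' hu => absurd hu nat_ne_prod, fun u' v' hu => absurd hu nat_ne_arrow⟩
    exact absurd (hu ▸ nb_nat) (not_nb_bullet _)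

theorem sem_const {i k t} (h : KappaTy k t) : Sem i t (.const k) := by
  cases h with
  | pair ht hs =>
    refine .arr (.of_nf (nf_const _)) fun j _ a ha => .arr (.of_nf (nf_pair1 _)) fun k hk b hb => ?_
    exact .base (ht.prod hs) (interp_pair (interp_mono hk ha) hb)
  | fst ht hs =>
    refine .arr (.of_nf (nf_const _)) fun j _ a ha => .base ht ?_
    cases j with
    | zero => trivial
    | succ j =>
      obtain ⟨f, hr, hf | ⟨c, d, rfl, hc, hd⟩⟩ := interp_prod_inv ht hs ha
      · exact interp_exp hr.fst (interp_neu (.fst hf))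
      · exact interp_exp (hr.fst.tail (.head (.fst _ _))) hc
  | snd ht hs =>
    refine .arr (.of_nf (nf_const _)) fun j _ a ha => .base hs ?_
    cases j with
    | zero => trivial
    | succ j =>
      obtain ⟨f, hr, hf | ⟨c, d, rfl, hc, hd⟩⟩ := interp_prod_inv ht hs ha
      · exact interp_exp hr.snd (interp_neu (.snd hf))
      · exact interp_exp (hr.snd.tail (.head (.snd _ _))) hd
  | zero => exact .base isType_nat (interp_nat (.of_nf (nf_const _)))
  | succ =>
    refine .arr (.of_nf (nf_const _)) fun j _ a ha => .base isType_nat ?_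
    cases j with
    | zero => trivial
    | succ j =>
      obtain ⟨f, hr, hf⟩ := ((interpStep_iff _ _ _).1 ha isType_nat.acc).2.1 nb_nat
      exact interp_nat ⟨_, hr.succ, nf_app (nf_const _) (by simp) (by simp) (by simp)
        (fun _ => hf)⟩

theorem fundamental {Γ : Ctx} {e t} (h : Types Γ e t) : ∀ (i : ℕ) (ρ : ℕ → Expr),
    (∀ x s, Γ x = some s → interp i s (ρ x)) → Sem i t (substE ρ e) := by
  induction h with
  | ax hx ht => intro i ρ hρ; exact .base ht (hρ _ _ hx)
  | const hk => intro i ρ hρ; exact sem_const hk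
  | bulletI _ ih =>
    intro i ρ hρ
    cases i with
    | zero => exact .zero
    | succ i => exact .bul ((ih _ ρ hρ).mono (Nat.le_succ i))
  | @arrowI Γ e n t s _ ih =>
    intro i ρ hρ
    rw [sem_bulletN]
    refine .arr (.of_nf (nf_lam _)) fun j hj a ha => ?_
    cases j with
    | zero => exact .zero
    | succ j =>
      refine Sem.exp (Relation.ReflTransGen.single (.head (.beta _ _))) ?_
      rw [subst0_lift]
      have := ih (j + 1 + n) (consS a ρ) ?_
      · rw [sem_bulletN, Nat.add_sub_cancel] at this
        exact this
      · intro x u hx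
        cases x with
        | zero =>
          cases hx
          rw [interp_bulletN, Nat.add_sub_cancel]
          exact ha
        | succ x => exact interp_mono (by omega) (hρ x u hx)
  | arrowE _ _ ih1 ih2 =>
    intro i ρ hρ
    have h1 := ih1 i ρ hρ
    have h2 := ih2 i ρ hρ
    rw [sem_bulletN] at h1 h2 ⊢
    exact h1.app h2.interp

theorem whnf_of_types {Γ : Ctx} {e t} (h : Types Γ e t) (ht : t ≠ binf) : HasWhnf e := by
  obtain ⟨n, u, rfl, hu⟩ := exists_nb ht
  have := fundamental h (n + 1) .var (fun x s _ => interp_neu (.var x))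
  rw [subst_id, sem_bulletN, Nat.add_sub_cancel_left] at this
  exact Sem.whnf (i := 0) this hu

/-! ### Head normal forms -/

theorem spine_snoc (h : Expr) (args : List Expr) (a : Expr) :
    spineApp h (args ++ [a]) = .app (spineApp h args) a := by
  simp [spineApp]

theorem spine_cons (h : Expr) (args : List Expr) (a : Expr) :
    spineApp h (a :: args) = spineApp (.app h a) args := rfl

theorem nf_app_left {a b : Expr} (h : NormalForm (.app a b)) : NormalForm a :=
  fun f hf => h _ (hf.app b)

theorem nf_spine {h : Expr} {args : List Expr} (hn : NormalForm (spineApp h args)) :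
    NormalForm h := by
  induction args generalizing h with
  | nil => exact hn
  | cons a args ih => exact nf_app_left (ih hn)

theorem nf_cases {e : Expr} (h : NormalForm e) : (∃ f, e = .lam f) ∨
    (∃ x args, e = spineApp (.var x) args) ∨ ∃ k args, e = spineApp (.const k) args := by
  induction e with
  | var x => exact Or.inr (Or.inl ⟨x, [], rfl⟩)
  | const k => exact Or.inr (Or.inr ⟨k, [], rfl⟩)
  | lam e _ => exact Or.inl ⟨e, rfl⟩
  | app a b iha _ =>
    rcases iha (nf_app_left h) with ⟨f, rfl⟩ | ⟨x, args, rfl⟩ | ⟨k, args, rfl⟩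
    · exact absurd (Red.head (.beta _ _)) (h _)
    · exact Or.inr (Or.inl ⟨x, args ++ [b], (spine_snoc _ _ _).symm⟩)
    · exact Or.inr (Or.inr ⟨k, args ++ [b], (spine_snoc _ _ _).symm⟩)

/-- All types of the context are tail finite. -/
def TFCtx (Γ : Ctx) : Prop := ∀ x s, Γ x = some s → TailFinite s

theorem TFCtx.cons {Γ : Ctx} {t} (h : TFCtx Γ) (ht : TailFinite t) : TFCtx (Ctx.cons t Γ) := by
  intro x s hx
  cases x with
  | zero => cases hx; exact ht
  | succ x => exact h x s hx

theorem Peel.head {e f g : Expr} (hr : RedStar e (.lam f)) (h : Peel f g) : Peel e g := by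
  induction h with
  | refl => exact .step (.refl _) hr
  | step _ h2 ih => exact .step ih h2

theorem TailFinite.acc {t : PseudoType} (h : TailFinite t) :
    Acc (fun v u => AltStep u v) t := by
  by_contra hc
  exact h.2 t Relation.ReflTransGen.refl (exists_chain hc)

theorem arrow_parts {n : ℕ} {t s : PseudoType} (h : TailFinite (tbulletN n (tarrow t s))) :
    TailFinite (tbulletN n t) ∧ TailFinite (tbulletN n s) := by
  rw [tf_bulletN] at h ⊢
  rw [tf_bulletN]
  exact ⟨h.child (child_arrow.2 (Or.inl rfl)), h.child (child_arrow.2 (Or.inr rfl))⟩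

theorem prod_parts {n : ℕ} {t s : PseudoType} (h : TailFinite (tbulletN n (tprod t s))) :
    TailFinite (tbulletN n t) ∧ TailFinite (tbulletN n s) := by
  rw [tf_bulletN] at h ⊢
  rw [tf_bulletN]
  exact ⟨h.child (child_prod.2 (Or.inl rfl)), h.child (child_prod.2 (Or.inr rfl))⟩

theorem hnf_of_types {t : PseudoType} (hacc : Acc (fun v u => AltStep u v) t) :
    ∀ {Γ : Ctx} {e : Expr} (n : ℕ), TailFinite t → Types Γ e (tbulletN n t) →
      HasHnf e := by
  induction hacc with
  | intro t _ ih =>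
    intro Γ e n ht h
    have htn : TailFinite (tbulletN n t) := tf_bulletN.2 ht
    obtain ⟨f, hr, hf⟩ := whnf_of_types h (htn.1 _ Relation.ReflTransGen.refl)
    rcases nf_cases hf with ⟨g, rfl⟩ | ⟨x, args, rfl⟩ | ⟨k, args, rfl⟩
    · obtain ⟨k, t₁, s, he, hg⟩ := inv_lam (hr.types h)
      have hk : TailFinite (tbulletN k (tarrow t₁ s)) := he ▸ htn
      have hs : TailFinite s := tf_bulletN.1 (arrow_parts hk).2
      have halt : AltStep t s := by
        rcases le_or_gt n k with hnk | hnk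
        · obtain ⟨d, rfl⟩ := Nat.exists_eq_add_of_le hnk
          rw [bulletN_add] at he
          exact ⟨d, t₁, bulletN_inj he⟩
        · obtain ⟨d, rfl⟩ := Nat.exists_eq_add_of_lt hnk
          rw [add_assoc, bulletN_add, bulletN_succ] at he
          exact absurd ((bulletN_inj he).symm ▸ nb_arrow t₁ s) (not_nb_bullet _)
      obtain ⟨g', hp, hh⟩ := ih s halt k hs hg
      exact ⟨g', hp.head hr, hh⟩
    · exact ⟨e, .refl _, Or.inl ⟨x, args, hr⟩⟩
    · exact ⟨e, .refl _, Or.inr ⟨k, args, hr, hf⟩⟩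

/-- Typable with tail finite types. -/
def Good (e : Expr) : Prop := ∃ Γ t, TFCtx Γ ∧ TailFinite t ∧ Types Γ e t

theorem Good.hnf {e : Expr} (h : Good e) : HasHnf e := by
  obtain ⟨Γ, t, _, ht, h⟩ := h
  exact hnf_of_types ht.acc 0 ht h

theorem Good.red {e f : Expr} (h : Good e) (hr : RedStar e f) : Good f := by
  obtain ⟨Γ, t, hΓ, ht, h⟩ := h
  exact ⟨Γ, t, hΓ, ht, hr.types h⟩

theorem Good.peel {e g : Expr} (h : Good e) (hp : Peel e g) : Good g := by
  induction hp with
  | refl => exact h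
  | step _ hr ih =>
    obtain ⟨Γ, t, hΓ, ht, h⟩ := ih.red hr
    obtain ⟨n, t₁, s, rfl, hb⟩ := inv_lam h
    exact ⟨_, _, hΓ.cons (arrow_parts ht).1, (arrow_parts ht).2, hb⟩

theorem Neu.tf {Γ : Ctx} {e t} (hΓ : TFCtx Γ) (hn : Neu e) (h : Types Γ e t) :
    TailFinite t := by
  induction hn generalizing t with
  | var x =>
    obtain ⟨n, u, rfl, hx⟩ := inv_var h
    exact tf_bulletN.2 (hΓ _ _ hx)
  | app a _ ih =>
    obtain ⟨n, t₁, s, rfl, h1, h2⟩ := inv_app h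
    exact (arrow_parts (ih h1)).2
  | fst _ ih =>
    obtain ⟨n, u, v, rfl, h1⟩ := inv_fst h
    exact (prod_parts (ih h1)).1
  | snd _ ih =>
    obtain ⟨n, u, v, rfl, h1⟩ := inv_snd h
    exact (prod_parts (ih h1)).2

theorem neu_spine {Γ : Ctx} {h : Expr} (hΓ : TFCtx Γ) (hn : Neu h) (args : List Expr) {t}
    (ht : Types Γ (spineApp h args) t) : ∀ a ∈ args, Good a := by
  induction args generalizing h t with
  | nil => simp
  | cons b args ih =>
    intro a ha
    rw [spine_cons] at ht
    rcases List.mem_cons.1 ha with rfl | ha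
    · have : ∃ t', Types Γ (.app h a) t' := by
        clear ih ha hn
        generalize Expr.app h a = e at ht
        induction args generalizing e with
        | nil => exact ⟨_, ht⟩
        | cons c args ih =>
          obtain ⟨t', h'⟩ := ih _ ht
          obtain ⟨n, t₁, s, rfl, h1, h2⟩ := inv_app h'
          exact ⟨_, h1⟩
      obtain ⟨t', h'⟩ := this
      obtain ⟨n, t₁, s, rfl, h1, h2⟩ := inv_app h'
      exact ⟨Γ, _, hΓ, (arrow_parts (hn.tf hΓ h1)).1, h2⟩
    · exact ih (.app b hn) ht a ha

theorem spine_head {Γ : Ctx} {h : Expr} {args : List Expr} {t}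
    (ht : Types Γ (spineApp h args) t) : ∃ t', Types Γ h t' := by
  induction args generalizing h with
  | nil => exact ⟨_, ht⟩
  | cons c args ih =>
    obtain ⟨t', h'⟩ := ih ht
    obtain ⟨n, t₁, s, rfl, h1, h2⟩ := inv_app h'
    exact ⟨_, h1⟩

/-- Classification of typable normal forms. -/
inductive Cls : Expr → Prop
  | neu {e} : Neu e → Cls e
  | lam (e) : Cls (.lam e)
  | const (k) : Cls (.const k)
  | pair1 (a) : Cls (.app (.const .pair) a)
  | pair2 (a b) : Cls (mkPair a b)
  | succ (a) : Cls (.app (.const .succ) a)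

theorem Cls.of_prod {Γ : Ctx} {e : Expr} {n u v} (hc : Cls e)
    (h : Types Γ e (tbulletN n (tprod u v))) : Neu e ∨ ∃ a b, e = mkPair a b := by
  cases hc with
  | neu h => exact Or.inl h
  | lam e =>
    obtain ⟨m, a, b, h4, -⟩ := inv_lam h
    exact absurd (bulletN_nb_inj (nb_prod _ _) (nb_arrow _ _) h4).2 prod_ne_arrow
  | const k =>
    obtain ⟨m, w, h4, hk⟩ := inv_const h
    cases hk with
    | zero => exact absurd (bulletN_nb_inj (nb_prod _ _) nb_nat h4).2.symm nat_ne_prod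
    | _ => exact absurd (bulletN_nb_inj (nb_prod _ _) (nb_arrow _ _) h4).2 prod_ne_arrow
  | pair1 a =>
    obtain ⟨m, a, b, h4, -⟩ := inv_pair1 h
    exact absurd (bulletN_nb_inj (nb_prod _ _) (nb_arrow _ _) h4).2 prod_ne_arrow
  | pair2 a b => exact Or.inr ⟨a, b, rfl⟩
  | succ a =>
    obtain ⟨m, h4, -⟩ := inv_succ h
    exact absurd (bulletN_nb_inj (nb_prod _ _) nb_nat h4).2.symm nat_ne_prod

theorem pair2_not_fun {Γ : Ctx} {a b c t} : ¬ Types Γ (.app (mkPair a b) c) t := by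
  intro h
  obtain ⟨n, t₁, s, rfl, h1, h2⟩ := inv_app h
  obtain ⟨m, u, v, h4, -⟩ := inv_pair2 h1
  exact absurd (bulletN_nb_inj (nb_arrow _ _) (nb_prod _ _) h4).2.symm prod_ne_arrow

theorem zero_not_fun {Γ : Ctx} {c t} : ¬ Types Γ (.app (.const .zero) c) t := by
  intro h
  obtain ⟨n, t₁, s, rfl, h1, h2⟩ := inv_app h
  obtain ⟨m, u, h4, hk⟩ := inv_const h1
  cases hk
  exact absurd (bulletN_nb_inj (nb_arrow _ _) nb_nat h4).2.symm nat_ne_arrow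

theorem succ_not_fun {Γ : Ctx} {a c t} : ¬ Types Γ (.app (.app (.const .succ) a) c) t := by
  intro h
  obtain ⟨n, t₁, s, rfl, h1, h2⟩ := inv_app h
  obtain ⟨m, h4, -⟩ := inv_succ h1
  exact absurd (bulletN_nb_inj (nb_arrow _ _) nb_nat h4).2.symm nat_ne_arrow

theorem nf_class {Γ : Ctx} {e t} (hn : NormalForm e) (h : Types Γ e t) : Cls e := by
  induction e generalizing t with
  | var x => exact .neu (.var x)
  | const k => exact .const k
  | lam e _ => exact .lam e
  | app a b iha ihb =>
    obtain ⟨n, t₁, s, rfl, h1, h2⟩ := inv_app h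
    cases iha (nf_app_left hn) h1 with
    | neu h3 => exact .neu (.app b h3)
    | lam f => exact absurd (Red.head (.beta _ _)) (hn _)
    | const k =>
      cases k with
      | pair => exact .pair1 b
      | cfst =>
        obtain ⟨m, u, v, h4, h5⟩ := inv_fst h
        rcases (ihb (fun f hf => hn _ hf.fst) h5).of_prod h5 with h6 | ⟨c, d, rfl⟩
        · exact .neu (.fst h6)
        · exact absurd (Red.head (.fst _ _)) (hn _)
      | csnd =>
        obtain ⟨m, u, v, h4, h5⟩ := inv_snd h
        rcases (ihb (fun f hf => hn _ hf.snd) h5).of_prod h5 with h6 | ⟨c, d, rfl⟩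
        · exact .neu (.snd h6)
        · exact absurd (Red.head (.snd _ _)) (hn _)
      | zero => exact absurd h zero_not_fun
      | succ => exact .succ b
    | pair1 c => exact .pair2 c b
    | pair2 c d => exact absurd h pair2_not_fun
    | succ c => exact absurd h succ_not_fun

theorem good_const {k : Const} {args : List Expr} (h : Good (spineApp (.const k) args))
    (hn : NormalForm (spineApp (.const k) args)) : ∀ a ∈ args, Good a := by
  obtain ⟨Γ, t, hΓ, ht, h⟩ := h
  cases args with
  | nil => simp
  | cons b args =>
    rw [spine_cons] at h hn
    obtain ⟨t', hb⟩ := spine_head h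
    have hnb := nf_spine hn
    cases k with
    | pair =>
      cases args with
      | nil =>
        intro a ha
        rw [List.mem_singleton] at ha
        subst ha
        obtain ⟨n, u, v, rfl, h1⟩ := inv_pair1 h
        exact ⟨Γ, _, hΓ, (prod_parts (arrow_parts ht).2).1, h1⟩
      | cons c args =>
        cases args with
        | nil =>
          obtain ⟨n, u, v, rfl, h1, h2⟩ := inv_pair2 h
          intro a ha
          simp only [List.mem_cons, List.not_mem_nil, or_false] at ha
          rcases ha with rfl | rfl
          · exact ⟨Γ, _, hΓ, (prod_parts ht).1, h1⟩
          · exact ⟨Γ, _, hΓ, (prod_parts ht).2, h2⟩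
        | cons d args =>
          obtain ⟨t'', h3⟩ := spine_head (h := .app (mkPair b c) d) h
          exact absurd h3 pair2_not_fun
    | cfst =>
      obtain ⟨m, u, v, h4, h5⟩ := inv_fst hb
      intro a ha
      rcases (nf_class (fun f hf => hnb _ hf.fst) h5).of_prod h5 with h6 | ⟨c, d, rfl⟩
      · rcases List.mem_cons.1 ha with rfl | ha
        · exact ⟨Γ, _, hΓ, h6.tf hΓ h5, h5⟩
        · exact neu_spine hΓ (.fst h6) args h a ha
      · exact absurd (Red.head (.fst _ _)) (hnb _)
    | csnd =>
      obtain ⟨m, u, v, h4, h5⟩ := inv_snd hb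
      intro a ha
      rcases (nf_class (fun f hf => hnb _ hf.snd) h5).of_prod h5 with h6 | ⟨c, d, rfl⟩
      · rcases List.mem_cons.1 ha with rfl | ha
        · exact ⟨Γ, _, hΓ, h6.tf hΓ h5, h5⟩
        · exact neu_spine hΓ (.snd h6) args h a ha
      · exact absurd (Red.head (.snd _ _)) (hnb _)
    | zero => exact absurd hb zero_not_fun
    | succ =>
      cases args with
      | nil =>
        intro a ha
        rw [List.mem_singleton] at ha
        subst ha
        obtain ⟨n, rfl, h1⟩ := inv_succ h
        exact ⟨Γ, _, hΓ, ht, h1⟩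
      | cons c args =>
        obtain ⟨t'', h3⟩ := spine_head (h := .app (.app (.const .succ) b) c) h
        exact absurd h3 succ_not_fun

theorem Good.bsub {e a : Expr} (h : Good e) (hs : BSub e a) : Good a := by
  cases hs with
  | var hp hr ha =>
    obtain ⟨Γ, t, hΓ, _, h⟩ := (h.peel hp).red hr
    exact neu_spine hΓ (.var _) _ h a ha
  | const hp hr hn ha => exact good_const ((h.peel hp).red hr) hn a ha

/-- Productivity II: if `t` and all the types in `Γ` are tail
finite and `Γ ⊢ e : t` in λ•→, then the Böhm tree of `e` has no `⊥`'s. -/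
theorem productivity_bohm (Γ : Ctx) (e : Expr) (t : PseudoType)
    (ht : TailFinite t) (hΓ : ∀ x s, Γ x = some s → TailFinite s)
    (h : Types Γ e t) : BTBotFree e := by
  intro f hf
  have hg : Good e := ⟨Γ, t, hΓ, ht, h⟩
  have : Good f := by
    induction hf with
    | refl => exact hg
    | tail _ hs ih => exact ih.bsub hs
  exact this.hnf

end LambdaBullet
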